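/- Let p ≥ 1 and let Σ ∈ ℝ^{p×p} be a symmetric positive definite matrix with eigenvalues λ_1 ≥ λ_2 ≥ ⋯ ≥ λ_p > 0. Fix M ≥ 3, γ ≥ 0 with γ ≠ 1, and α > 0 with α ≠ 2(1+γ)/λ_j for every 1 ≤ j ≤ p, and assume γ > 1 or α > 2(1+γ)/λ_1. Then there exists ε > 0 such that for all symmetric matrices Σ̂^{(1)}, …, Σ̂^{(M)} ∈ ℝ^{p×p} with ‖Σ̂^{(m)} − Σ‖ ≤ ε for every m (operator norm), and all vectors b^{(1)}, …, b^{(M)} ∈ ℝ^p: the block matrix Ω built from Δ^{(m)} = (1+γ)I_p − αΣ̂^{(m)} is invertible with stable solution θ* = αΩ^{-1}b* = (θ^{(1)ᵀ}, …, θ^{(M)ᵀ})ᵀ, and there exist initial vectors θ^{(0,M)} ≠ θ^{(M)}, θ^{(0,M−1)} ≠ θ^{(M−1)} for which the FMGDM iterates θ^{(t,M)} do not converge to θ^{(M)} as t → ∞. -/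

import Mathlib

set_option autoImplicit false

open Matrix Polynomial Filter

/-- The `M × M` block matrix (with `p × p` blocks) whose `(m, m)` block is `I_p`,
whose `(m, m - 1 mod M)` block is `-Δ m`, whose `(m, m - 2 mod M)` block is `γ • I_p`,
and whose remaining blocks are zero. -/
def blockOmega (M p : ℕ) (γ : ℝ) (Δ : Fin M → Matrix (Fin p) (Fin p) ℝ) :
    Matrix (Fin M × Fin p) (Fin M × Fin p) ℝ :=
  Matrix.of fun x y =>
    if (y.1 : ℕ) = (x.1 : ℕ) then (1 : Matrix (Fin p) (Fin p) ℝ) x.2 y.2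
    else if (y.1 : ℕ) = ((x.1 : ℕ) + (M - 1)) % M then -(Δ x.1 x.2 y.2)
    else if (y.1 : ℕ) = ((x.1 : ℕ) + (M - 2)) % M then
      γ * (1 : Matrix (Fin p) (Fin p) ℝ) x.2 y.2
    else 0

/-- The operator (spectral) norm of a real matrix, i.e. the norm of the induced
continuous linear endomorphism of Euclidean space. -/
noncomputable def matOpNorm {n : Type*} [Fintype n] [DecidableEq n]
    (A : Matrix n n ℝ) : ℝ :=
  ‖(Matrix.toEuclideanCLM (𝕜 := ℝ) A : EuclideanSpace ℝ n →L[ℝ] EuclideanSpace ℝ n)‖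

/-- A positive definite binary quadratic form dominates a multiple of the sum of squares. -/
lemma exists_pos_mul_sq_add_sq_le {P H R : ℝ} (hP : 0 < P) (hdet : H ^ 2 < P * R) :
    ∃ δ > 0, ∀ a b : ℝ, δ * (a ^ 2 + b ^ 2) ≤ P * a ^ 2 + 2 * H * a * b + R * b ^ 2 := by
  have hR : 0 < R := by
    by_contra h
    nlinarith [sq_nonneg H]
  have hPR : 0 < P + R := by linarith
  refine ⟨(P * R - H ^ 2) / (P + R), div_pos (by linarith) hPR, fun a b => ?_⟩
  rw [div_mul_eq_mul_div, div_le_iff₀ hPR]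
  nlinarith [sq_nonneg (P * a + H * b), sq_nonneg (H * a + R * b)]

/-- The scalar recursion `a₂ = c a₁ - γ a₀`, when hyperbolic, strictly increases some quadratic
form. -/
lemma exists_quadratic_increasing {γ c : ℝ} (hγ0 : 0 ≤ γ) (hγ1 : γ ≠ 1)
    (hc : c ^ 2 ≠ (1 + γ) ^ 2) :
    ∃ A B F δ : ℝ, 0 < δ ∧ ((1 < γ ∨ (1 + γ) ^ 2 < c ^ 2) → 0 < A) ∧
      ∀ a b : ℝ, A * a ^ 2 + 2 * B * a * b + F * b ^ 2 + δ * (a ^ 2 + b ^ 2) ≤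
        A * (c * a - γ * b) ^ 2 + 2 * B * (c * a - γ * b) * a + F * a ^ 2 := by
  rcases lt_or_gt_of_ne hc with h | h
  · have hA : ∃ A : ℝ, 0 < A * ((γ - 1) * ((1 + γ) ^ 2 - c ^ 2)) ∧ (1 < γ → 0 < A) := by
      rcases lt_or_gt_of_ne hγ1 with h1 | h1
      · exact ⟨-1, by nlinarith, fun h2 => by linarith⟩
      · exact ⟨1, by nlinarith, fun _ => one_pos⟩
    obtain ⟨A, hA, hA'⟩ := hA
    have h1 : 0 < 1 + γ := by linarith
    set κ : ℝ := A * ((γ - 1) * ((1 + γ) ^ 2 - c ^ 2)) / (2 * (1 + γ)) with hκ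
    have hκ0 : 0 < κ := by positivity
    refine ⟨A, -(A * c * γ / (1 + γ)), A * γ ^ 2 - κ, κ, hκ0, ?_, fun a b => le_of_eq ?_⟩
    · rintro (h2 | h2)
      · exact hA' h2
      · linarith
    · rw [hκ]
      field_simp
      ring
  · have hs : 0 ≤ c ^ 2 - 4 * γ := by nlinarith [sq_nonneg (1 - γ)]
    obtain ⟨s, hs2⟩ : ∃ s, s ^ 2 = c ^ 2 - 4 * γ := ⟨_, Real.sq_sqrt hs⟩
    have key : ∃ μ ν : ℝ, μ + ν = c ∧ μ * ν = γ ∧ 1 < μ ^ 2 ∧ ν ^ 2 < 1 := by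
      have hprod : (((c + s) / 2) ^ 2 - 1) * (((c - s) / 2) ^ 2 - 1) < 0 := by
        have : ((c + s) / 2) * ((c - s) / 2) = γ := by nlinarith
        have h3 : (((c + s) / 2) ^ 2 - 1) * (((c - s) / 2) ^ 2 - 1) =
          (((c + s) / 2) * ((c - s) / 2) + 1) ^ 2 - c ^ 2 := by ring
        rw [h3, this]
        linarith
      rcases mul_neg_iff.1 hprod with ⟨h1, h2⟩ | ⟨h1, h2⟩
      · exact ⟨(c + s) / 2, (c - s) / 2, by ring, by nlinarith, by linarith, by linarith⟩
      · exact ⟨(c - s) / 2, (c + s) / 2, by ring, by nlinarith, by linarith, by linarith⟩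
    obtain ⟨μ, ν, rfl, rfl, hμ, hν⟩ := key
    have hne : 0 < (μ - ν) ^ 2 := by
      refine sq_pos_of_ne_zero fun h0 => ?_
      have : μ = ν := by linarith
      subst this
      linarith
    have hP : 0 < 2 * (μ ^ 2 - 1) + (1 - ν ^ 2) := by linarith
    obtain ⟨δ, hδ, hle⟩ := exists_pos_mul_sq_add_sq_le
      (P := 2 * (μ ^ 2 - 1) + (1 - ν ^ 2))
      (H := -(2 * (μ ^ 2 - 1) * ν + (1 - ν ^ 2) * μ))
      (R := 2 * (μ ^ 2 - 1) * ν ^ 2 + (1 - ν ^ 2) * μ ^ 2) hP (by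
        have : 0 < 2 * (μ ^ 2 - 1) * (1 - ν ^ 2) * (μ - ν) ^ 2 := by
          have h1 : 0 < μ ^ 2 - 1 := by linarith
          have h2 : 0 < 1 - ν ^ 2 := by linarith
          positivity
        nlinarith)
    refine ⟨1, -(2 * ν - μ), 2 * ν ^ 2 - μ ^ 2, δ, hδ, fun _ => one_pos, fun a b => ?_⟩
    have := hle a b
    nlinarith

/-- A robust version of `exists_quadratic_increasing`, tolerating an additive error `r` in the
recursion. -/
lemma exists_quadratic_increasing_of_error {γ c : ℝ} (hγ0 : 0 ≤ γ) (hγ1 : γ ≠ 1)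
    (hc : c ^ 2 ≠ (1 + γ) ^ 2) :
    ∃ A B F δ κ : ℝ, 0 < δ ∧ 0 < κ ∧ ((1 < γ ∨ (1 + γ) ^ 2 < c ^ 2) → 0 < A) ∧
      ∀ a b r : ℝ, A * a ^ 2 + 2 * B * a * b + F * b ^ 2 + δ * (a ^ 2 + b ^ 2) - κ * r ^ 2 ≤
        A * (c * a - γ * b - r) ^ 2 + 2 * B * (c * a - γ * b - r) * a + F * a ^ 2 := by
  obtain ⟨A, B, F, δ, hδ, hA, h⟩ := exists_quadratic_increasing hγ0 hγ1 hc
  refine ⟨A, B, F, δ / 2, 2 / δ * ((A * c + B) ^ 2 + (A * γ) ^ 2) + |A| + 1, by positivity,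
    by positivity, hA, fun a b r => ?_⟩
  have h1 : 2 * r * (A * c + B) * a ≤ δ / 2 * a ^ 2 + 2 / δ * (A * c + B) ^ 2 * r ^ 2 := by
    have : 0 ≤ δ / 2 * (a - 2 / δ * (A * c + B) * r) ^ 2 := by positivity
    have h2 : δ / 2 * (a - 2 / δ * (A * c + B) * r) ^ 2 =
      δ / 2 * a ^ 2 + 2 / δ * (A * c + B) ^ 2 * r ^ 2 - 2 * r * (A * c + B) * a := by
      field_simp
      ring
    linarith
  have h2 : -(2 * r * (A * γ) * b) ≤ δ / 2 * b ^ 2 + 2 / δ * (A * γ) ^ 2 * r ^ 2 := by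
    have : 0 ≤ δ / 2 * (b + 2 / δ * (A * γ) * r) ^ 2 := by positivity
    have h2 : δ / 2 * (b + 2 / δ * (A * γ) * r) ^ 2 =
      δ / 2 * b ^ 2 + 2 / δ * (A * γ) ^ 2 * r ^ 2 + 2 * r * (A * γ) * b := by
      field_simp
      ring
    linarith
  have h3 : -(|A| * r ^ 2) ≤ A * r ^ 2 := by nlinarith [neg_abs_le A, sq_nonneg r]
  have h4 := h a b
  nlinarith [sq_nonneg r]

/-- The operator norm bounds the growth of the dot-product square. -/
lemma dotProduct_mulVec_self_le {n : Type*} [Fintype n] [DecidableEq n] (A : Matrix n n ℝ)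
    (x : n → ℝ) : (A *ᵥ x) ⬝ᵥ (A *ᵥ x) ≤ matOpNorm A ^ 2 * (x ⬝ᵥ x) := by
  have hsq : ∀ z : n → ℝ, z ⬝ᵥ z = ‖WithLp.toLp 2 z‖ ^ 2 := fun z => by
    rw [EuclideanSpace.real_norm_sq_eq]
    simp [dotProduct, sq]
  rw [hsq, hsq, ← mul_pow]
  refine pow_le_pow_left₀ (norm_nonneg _) ?_ 2
  rw [← Matrix.toEuclideanCLM_toLp (𝕜 := ℝ)]
  exact ContinuousLinearMap.le_opNorm _ _

lemma dotProduct_self_nonneg_real {n : Type*} [Fintype n] (x : n → ℝ) : 0 ≤ x ⬝ᵥ x :=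
  Finset.sum_nonneg fun i _ => mul_self_nonneg (x i)

lemma sum_sq_dotProduct_eigenvectorBasis {n : Type*} [Fintype n] [DecidableEq n]
    {S : Matrix n n ℝ} (hS : S.IsHermitian) (x : n → ℝ) :
    ∑ j, ((hS.eigenvectorBasis j).ofLp ⬝ᵥ x) ^ 2 = x ⬝ᵥ x := by
  have h := hS.eigenvectorBasis.sum_sq_inner_right (WithLp.toLp 2 x)
  rw [EuclideanSpace.real_norm_sq_eq] at h
  simp only [EuclideanSpace.inner_eq_star_dotProduct, star_trivial] at h
  simp only [dotProduct_comm _ x, h]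
  simp [dotProduct, sq]

lemma eigenvectorBasis_dotProduct_mulVec {n : Type*} [Fintype n] [DecidableEq n]
    {S : Matrix n n ℝ} (hS : S.IsHermitian) (j : n) (x : n → ℝ) :
    (hS.eigenvectorBasis j).ofLp ⬝ᵥ (S *ᵥ x) =
      hS.eigenvalues j * ((hS.eigenvectorBasis j).ofLp ⬝ᵥ x) := by
  have hT : Sᵀ = S := (conjTranspose_eq_transpose_of_trivial S).symm.trans hS
  rw [dotProduct_mulVec, ← mulVec_transpose, hT, hS.mulVec_eigenvectorBasis, smul_dotProduct,
    smul_eq_mul]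

lemma eigenvectorBasis_dotProduct_eigenvectorBasis {n : Type*} [Fintype n] [DecidableEq n]
    {S : Matrix n n ℝ} (hS : S.IsHermitian) (i j : n) :
    (hS.eigenvectorBasis i).ofLp ⬝ᵥ (hS.eigenvectorBasis j).ofLp = if j = i then 1 else 0 := by
  have h := (orthonormal_iff_ite.1 hS.eigenvectorBasis.orthonormal) j i
  rwa [EuclideanSpace.inner_eq_star_dotProduct, star_trivial] at h

/-- A continuous function which strictly increases along the second-order recursion
`x₂ = ((1 + γ) - α N) x₁ - γ x₀`, uniformly over all matrices `N` near `S`, and which takes a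
positive value at some `(v, 0)`. -/
lemma exists_increasing_function {n : Type*} [Fintype n] [DecidableEq n]
    {S : Matrix n n ℝ} (hS : S.IsHermitian) {γ α : ℝ} (hγ0 : 0 ≤ γ) (hγ1 : γ ≠ 1) (hα : 0 < α)
    (hc : ∀ j, (1 + γ - α * hS.eigenvalues j) ^ 2 ≠ (1 + γ) ^ 2) (i : n)
    (hi : 1 < γ ∨ (1 + γ) ^ 2 < (1 + γ - α * hS.eigenvalues i) ^ 2) :
    ∃ ε > 0, ∃ δ > 0, ∃ Q : (n → ℝ) → (n → ℝ) → ℝ, ∃ v : n → ℝ,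
      Continuous (Function.uncurry Q) ∧ Q 0 0 = 0 ∧ 0 < Q v 0 ∧
      ∀ N : Matrix n n ℝ, matOpNorm (N - S) ≤ ε → ∀ x y : n → ℝ,
        Q x y + δ * (x ⬝ᵥ x + y ⬝ᵥ y) ≤
          Q (((1 + γ) • (1 : Matrix n n ℝ) - α • N) *ᵥ x - γ • y) x := by
  choose A B F δ κ hδ hκ hA hstep using
    fun j => exists_quadratic_increasing_of_error hγ0 hγ1 (hc j)
  obtain ⟨δ₀, hδ₀, hδle⟩ : ∃ d > 0, ∀ j, d ≤ δ j := by
    obtain ⟨j, -, hj⟩ := Finset.exists_min_image Finset.univ δ ⟨i, Finset.mem_univ i⟩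
    exact ⟨δ j, hδ j, fun k => hj k (Finset.mem_univ k)⟩
  obtain ⟨κ₀, hκ₀, hκle⟩ : ∃ d > 0, ∀ j, κ j ≤ d := by
    obtain ⟨j, -, hj⟩ := Finset.exists_max_image Finset.univ κ ⟨i, Finset.mem_univ i⟩
    exact ⟨κ j, hκ j, fun k => hj k (Finset.mem_univ k)⟩
  set w : n → n → ℝ := fun j => (hS.eigenvectorBasis j).ofLp with hw
  obtain ⟨ε, hε, hεle⟩ : ∃ ε > 0, κ₀ * (α ^ 2 * ε ^ 2) ≤ δ₀ / 2 := by
    refine ⟨√(δ₀ / (2 * κ₀ * α ^ 2)), Real.sqrt_pos.2 (by positivity), le_of_eq ?_⟩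
    rw [Real.sq_sqrt (by positivity)]
    field_simp
  refine ⟨ε, hε, δ₀ / 2, by positivity,
    fun x y => ∑ j, (A j * (w j ⬝ᵥ x) ^ 2 + 2 * B j * (w j ⬝ᵥ x) * (w j ⬝ᵥ y)
      + F j * (w j ⬝ᵥ y) ^ 2), w i, ?_, by simp, ?_, ?_⟩
  · simp only [Function.uncurry_def, dotProduct]
    fun_prop
  · simpa [hw, eigenvectorBasis_dotProduct_eigenvectorBasis] using hA i hi
  · intro N hN x y
    set r : n → ℝ := α • ((N - S) *ᵥ x) with hr
    have hr2 : κ₀ * (r ⬝ᵥ r) ≤ δ₀ / 2 * (x ⬝ᵥ x) := by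
      have hx : 0 ≤ x ⬝ᵥ x := dotProduct_self_nonneg_real x
      have h1 : (N - S) *ᵥ x ⬝ᵥ (N - S) *ᵥ x ≤ ε ^ 2 * (x ⬝ᵥ x) :=
        (dotProduct_mulVec_self_le _ _).trans <|
          mul_le_mul_of_nonneg_right (pow_le_pow_left₀ (norm_nonneg _) hN 2) hx
      calc κ₀ * (r ⬝ᵥ r) = κ₀ * α ^ 2 * ((N - S) *ᵥ x ⬝ᵥ (N - S) *ᵥ x) := by
            simp only [hr, smul_dotProduct, dotProduct_smul, smul_eq_mul]
            ring
        _ ≤ κ₀ * α ^ 2 * (ε ^ 2 * (x ⬝ᵥ x)) := by gcongr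
        _ = κ₀ * (α ^ 2 * ε ^ 2) * (x ⬝ᵥ x) := by ring
        _ ≤ _ := by gcongr
    have hcoord : ∀ j, w j ⬝ᵥ (((1 + γ) • (1 : Matrix n n ℝ) - α • N) *ᵥ x - γ • y) =
        (1 + γ - α * hS.eigenvalues j) * (w j ⬝ᵥ x) - γ * (w j ⬝ᵥ y) - w j ⬝ᵥ r := by
      intro j
      have h1 := eigenvectorBasis_dotProduct_mulVec hS j x
      simp only [hr, sub_mulVec, smul_mulVec, one_mulVec, dotProduct_sub, dotProduct_smul,
        smul_eq_mul, hw, h1]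
      ring
    have hsum := Finset.sum_le_sum fun j (_ : j ∈ Finset.univ) =>
      (hstep j (w j ⬝ᵥ x) (w j ⬝ᵥ y) (w j ⬝ᵥ r))
    simp only [hcoord]
    refine le_trans ?_ hsum
    have hδsum : δ₀ * (x ⬝ᵥ x + y ⬝ᵥ y) ≤
        ∑ j, δ j * ((w j ⬝ᵥ x) ^ 2 + (w j ⬝ᵥ y) ^ 2) := by
      rw [← sum_sq_dotProduct_eigenvectorBasis hS x, ← sum_sq_dotProduct_eigenvectorBasis hS y,
        ← Finset.sum_add_distrib, Finset.mul_sum]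
      exact Finset.sum_le_sum fun j _ => mul_le_mul_of_nonneg_right (hδle j) (by positivity)
    have hκsum : ∑ j, κ j * (w j ⬝ᵥ r) ^ 2 ≤ κ₀ * (r ⬝ᵥ r) := by
      rw [← sum_sq_dotProduct_eigenvectorBasis hS r, Finset.mul_sum]
      exact Finset.sum_le_sum fun j _ => mul_le_mul_of_nonneg_right (hκle j) (by positivity)
    have hy : 0 ≤ y ⬝ᵥ y := dotProduct_self_nonneg_real y
    simp only [Finset.sum_sub_distrib, Finset.sum_add_distrib] at hδsum ⊢
    simp only [mul_add, Finset.sum_add_distrib] at hδsum ⊢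
    have := mul_nonneg hδ₀.le hy
    linarith

lemma exists_second_order_sequence {V : Type*} (F : ℕ → V → V → V) (a b : V) :
    ∃ u : ℕ → V, u 0 = a ∧ u 1 = b ∧ ∀ k, u (k + 2) = F k (u (k + 1)) (u k) :=
  ⟨fun k => (Nat.rec (a, b) (fun k s => (s.2, F k s.2 s.1)) k : V × V).1, rfl, rfl, fun _ => rfl⟩

/-- Duality between a homogeneous second-order recursion with symmetric coefficients and the one
with the coefficients in reversed order. -/
lemma dotProduct_reversed_recursion {n : Type*} [Fintype n] {γ : ℝ} {N : ℕ}
    {D G : ℕ → Matrix n n ℝ} (hD : ∀ k, (D k).IsSymm) (hG : ∀ i j, i + j + 1 = N → G i = D j)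
    {e g : ℕ → n → ℝ} (he : ∀ k, e (k + 2) = D k *ᵥ e (k + 1) - γ • e k)
    (hg : ∀ k, g (k + 2) = G k *ᵥ g (k + 1) - γ • g k) (i j : ℕ) (hij : i + j = N) :
    g (i + 1) ⬝ᵥ e (j + 1) - γ * (g i ⬝ᵥ e j) = g 1 ⬝ᵥ e (N + 1) - γ * (g 0 ⬝ᵥ e N) := by
  induction i generalizing j with
  | zero => simp [← hij]
  | succ i ih =>
    rw [← ih (j + 1) (by omega), hg, he, hG i j (by omega)]
    have hsymm : (D j *ᵥ g (i + 1)) ⬝ᵥ e (j + 1) = g (i + 1) ⬝ᵥ (D j *ᵥ e (j + 1)) := by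
      rw [dotProduct_mulVec, ← mulVec_transpose, hD j]
    simp only [sub_dotProduct, dotProduct_sub, smul_dotProduct, dotProduct_smul, smul_eq_mul,
      hsymm]
    ring

/-- If a positive value of `Q` is available at `(v, 0)` and `Q` does not decrease along the
recursion, then some homogeneous solution with nonzero initial vectors does not tend to `0` along
multiples of the period. -/
lemma exists_solution_not_tendsto_zero {n : Type*} [Fintype n] [DecidableEq n] {γ : ℝ} {M : ℕ}
    (hM : 0 < M) {D : ℕ → Matrix n n ℝ} (hD : ∀ k, (D k).IsSymm)
    (hper : ∀ j k, j ≡ k [MOD M] → D j = D k)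
    {Q : (n → ℝ) → (n → ℝ) → ℝ} {v : n → ℝ} (hQ : Continuous (Function.uncurry Q))
    (hQ0 : Q 0 0 = 0) (hv : 0 < Q v 0)
    (hmono : ∀ k x y, Q x y ≤ Q (D k *ᵥ x - γ • y) x) :
    ∃ e : ℕ → n → ℝ, e 0 ≠ 0 ∧ e 1 ≠ 0 ∧ (∀ k, e (k + 2) = D k *ᵥ e (k + 1) - γ • e k) ∧
      ¬ Tendsto (fun t => e (M * t + 1)) atTop (nhds 0) := by
  by_contra! hcon
  have hv0 : v ≠ 0 := by
    rintro rfl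
    linarith
  set G : ℕ → Matrix n n ℝ := fun i => D (M * (i + 1) - (i + 1)) with hGdef
  obtain ⟨g, hg0, hg1, hg⟩ :=
    exists_second_order_sequence (fun k x y => G k *ᵥ x - γ • y) 0 v
  have hGD : ∀ t i j, i + j + 1 = M * t → G i = D j := by
    intro t i j hij
    refine hper _ _ (Nat.ModEq.add_right_cancel' (i + 1) ?_)
    have h1 : M * (i + 1) - (i + 1) + (i + 1) = M * (i + 1) :=
      Nat.sub_add_cancel (Nat.le_mul_of_pos_left _ hM)
    rw [h1, show j + (i + 1) = M * t by omega]
    simp [Nat.ModEq]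
  have hpair_ne : ∀ a b : n → ℝ, a ≠ 0 → b ≠ 0 →
      Tendsto (fun t => g (M * t + 1) ⬝ᵥ a - γ * (g (M * t) ⬝ᵥ b)) atTop (nhds 0) := by
    intro a b ha hb
    obtain ⟨e, he0, he1, he⟩ :=
      exists_second_order_sequence (fun k x y => D k *ᵥ x - γ • y) b a
    have hlim := hcon e (he0 ▸ hb) (he1 ▸ ha) he
    have hdot : Continuous fun x : n → ℝ => v ⬝ᵥ x := by
      simp only [dotProduct]
      fun_prop
    have hlim' := (hdot.tendsto 0).comp hlim
    rw [dotProduct_zero] at hlim'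
    refine hlim'.congr fun t => ?_
    have := dotProduct_reversed_recursion hD (hGD t) he hg (M * t) 0 (by simp)
    rw [hg0, hg1] at this
    simpa [he0, he1] using this.symm
  have hdecomp : ∀ a : n → ℝ, ∃ c d : n → ℝ, c ≠ 0 ∧ d ≠ 0 ∧ a = c - d := by
    intro a
    by_cases ha : a = 0
    · exact ⟨v, v, hv0, hv0, by simp [ha]⟩
    · exact ⟨(2 : ℝ) • a, a, by simpa using ha, ha, by rw [two_smul]; simp⟩
  have hpair : ∀ a b : n → ℝ,
      Tendsto (fun t => g (M * t + 1) ⬝ᵥ a - γ * (g (M * t) ⬝ᵥ b)) atTop (nhds 0) := by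
    intro a b
    obtain ⟨a₁, a₂, ha₁, ha₂, rfl⟩ := hdecomp a
    obtain ⟨b₁, b₂, hb₁, hb₂, rfl⟩ := hdecomp b
    have := (hpair_ne a₁ b₁ ha₁ hb₁).sub (hpair_ne a₂ b₂ ha₂ hb₂)
    rw [sub_zero] at this
    refine this.congr fun t => ?_
    simp only [dotProduct_sub]
    ring
  have hx : Tendsto (fun t => g (M * t + 1)) atTop (nhds 0) :=
    tendsto_pi_nhds.2 fun i => by simpa using hpair (Pi.single i 1) 0
  have hy : Tendsto (fun t => γ • g (M * t)) atTop (nhds 0) :=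
    tendsto_pi_nhds.2 fun i => by simpa using (hpair 0 (Pi.single i 1)).neg
  have hG : ∀ t, G (M * t) = G 0 := fun t => hper _ _ <| by
    refine Nat.ModEq.add_right_cancel' (M * t + 1) ?_
    have h1 : M * (M * t + 1) - (M * t + 1) + (M * t + 1) = M * (M * t + 1) :=
      Nat.sub_add_cancel (Nat.le_mul_of_pos_left _ hM)
    have h2 : M * (0 + 1) - (0 + 1) + (M * t + 1) = M * (t + 1) := by
      rw [zero_add, mul_one, mul_add_one]
      omega
    rw [h1, h2]
    simp [Nat.ModEq]
  have hz : Tendsto (fun t => g (M * t + 2)) atTop (nhds 0) := by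
    have hcont : Continuous fun x : n → ℝ => G 0 *ᵥ x := by fun_prop
    have := ((hcont.tendsto 0).comp hx).sub hy
    rw [mulVec_zero, sub_zero] at this
    refine this.congr fun t => ?_
    simp [hg, hG]
  have hQle : ∀ k, Q v 0 ≤ Q (g (k + 1)) (g k) := by
    intro k
    induction k with
    | zero => rw [hg0, hg1]
    | succ k ih =>
      rw [hg]
      exact ih.trans (hmono _ _ _)
  have hQlim := (hQ.tendsto (0, 0)).comp (hz.prodMk_nhds hx)
  have := ge_of_tendsto' hQlim fun t => hQle (M * t + 1)
  simp only [Function.uncurry] at this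
  linarith

/-- A strictly increasing function forbids nonzero periodic solutions. -/
lemma periodic_solution_eq_zero {n : Type*} [Fintype n] {γ δ : ℝ} {M : ℕ}
    {D : ℕ → Matrix n n ℝ} {Q : (n → ℝ) → (n → ℝ) → ℝ} (hδ : 0 < δ)
    (hstep : ∀ k x y, Q x y + δ * (x ⬝ᵥ x + y ⬝ᵥ y) ≤ Q (D k *ᵥ x - γ • y) x)
    {h : ℕ → n → ℝ} (hh : ∀ k, h (k + 2) = D k *ᵥ h (k + 1) - γ • h k)
    (h0 : h M = h 0) (h1 : h (M + 1) = h 1) (k : ℕ) (hk : k < M) : h k = 0 := by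
  have hsum : ∑ k ∈ Finset.range M, δ * (h (k + 1) ⬝ᵥ h (k + 1) + h k ⬝ᵥ h k) ≤ 0 := by
    calc _ ≤ ∑ k ∈ Finset.range M, (Q (h (k + 1 + 1)) (h (k + 1)) - Q (h (k + 1)) (h k)) := by
          refine Finset.sum_le_sum fun k _ => ?_
          rw [hh k]
          linarith [hstep k (h (k + 1)) (h k)]
      _ = 0 := by
          rw [Finset.sum_range_sub (fun k => Q (h (k + 1)) (h k)), h0, h1, zero_add, sub_self]
  have hnonneg : ∀ k ∈ Finset.range M, 0 ≤ δ * (h (k + 1) ⬝ᵥ h (k + 1) + h k ⬝ᵥ h k) :=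
    fun k _ => mul_nonneg hδ.le
      (add_nonneg (dotProduct_self_nonneg_real _) (dotProduct_self_nonneg_real _))
  have hterm := (Finset.sum_eq_zero_iff_of_nonneg hnonneg).1
    (le_antisymm hsum (Finset.sum_nonneg hnonneg)) k (Finset.mem_range.2 hk)
  have := (mul_eq_zero.1 hterm).resolve_left hδ.ne'
  exact dotProduct_self_eq_zero.1
    (by linarith [dotProduct_self_nonneg_real (h (k + 1)), dotProduct_self_nonneg_real (h k)])

lemma blockOmega_mulVec {M p : ℕ} (hM : 3 ≤ M) (γ : ℝ) (D : Fin M → Matrix (Fin p) (Fin p) ℝ)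
    (θ : Fin M × Fin p → ℝ) (m : Fin M) (i : Fin p) :
    (blockOmega M p γ D *ᵥ θ) (m, i) = θ (m, i)
      - (D m *ᵥ fun l => θ (⟨(m + (M - 1)) % M, Nat.mod_lt _ (by omega)⟩, l)) i
      + γ * θ (⟨(m + (M - 2)) % M, Nat.mod_lt _ (by omega)⟩, i) := by
  have hm := m.2
  have h1 : ((m : ℕ) + (M - 1)) % M ≠ m := by
    rcases Nat.eq_zero_or_pos (m : ℕ) with h | h
    · rw [Nat.mod_eq_of_lt (by omega)]; omega
    · rw [Nat.mod_eq_sub_mod (by omega), Nat.mod_eq_of_lt (by omega)]; omega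
  have h2 : ((m : ℕ) + (M - 2)) % M ≠ m := by
    rcases lt_or_ge (m : ℕ) 2 with h | h
    · rw [Nat.mod_eq_of_lt (by omega)]; omega
    · rw [Nat.mod_eq_sub_mod (by omega), Nat.mod_eq_of_lt (by omega)]; omega
  have h12 : ((m : ℕ) + (M - 2)) % M ≠ (m + (M - 1)) % M := by
    intro h
    have h3 : (m : ℕ) + (M - 2) ≡ m + (M - 1) [MOD M] := h
    have h4 := Nat.ModEq.add_left_cancel' _ h3
    have := h4.eq_of_lt_of_lt (by omega) (by omega)
    omega
  set m₁ : Fin M := ⟨(m + (M - 1)) % M, Nat.mod_lt _ (by omega)⟩ with hm₁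
  set m₂ : Fin M := ⟨(m + (M - 2)) % M, Nat.mod_lt _ (by omega)⟩ with hm₂
  have hne1 : m₁ ≠ m := fun h => h1 (congrArg Fin.val h)
  have hne2 : m₂ ≠ m := fun h => h2 (congrArg Fin.val h)
  have hne12 : m₂ ≠ m₁ := fun h => h12 (congrArg Fin.val h)
  have hentry : ∀ y : Fin M × Fin p, blockOmega M p γ D (m, i) y =
      (if y.1 = m then (1 : Matrix (Fin p) (Fin p) ℝ) i y.2 else 0)
        + (if y.1 = m₁ then -(D m i y.2) else 0)
        + (if y.1 = m₂ then γ * (1 : Matrix (Fin p) (Fin p) ℝ) i y.2 else 0) := by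
    rintro ⟨k, l⟩
    have e0 : ((k : ℕ) = m) ↔ k = m := Fin.ext_iff.symm
    have e1 : ((k : ℕ) = (m + (M - 1)) % M) ↔ k = m₁ := (Fin.ext_iff (b := m₁)).symm
    have e2 : ((k : ℕ) = (m + (M - 2)) % M) ↔ k = m₂ := (Fin.ext_iff (b := m₂)).symm
    simp only [blockOmega, of_apply, e0, e1, e2]
    by_cases c0 : k = m
    · subst c0
      simp [hne1.symm, hne2.symm]
    · by_cases c1 : k = m₁
      · simp [c1, hne1, hne12.symm]
      · simp [c0, c1]
  simp only [mulVec, dotProduct, hentry, Fintype.sum_prod_type, add_mul, ite_mul, zero_mul,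
    Finset.sum_add_distrib, one_apply]
  simp [Finset.sum_ite_irrel, sub_eq_add_neg]

/-- A solution of the block system, extended periodically, solves the second-order recursion. -/
lemma periodic_extension_recursion {M p : ℕ} (hM : 3 ≤ M) {γ : ℝ}
    {D : Fin M → Matrix (Fin p) (Fin p) ℝ} {θ : Fin M × Fin p → ℝ} {c : Fin M → Fin p → ℝ}
    (hθ : blockOmega M p γ D *ᵥ θ = fun x => c x.1 x.2) {h : ℕ → Fin p → ℝ}
    (hh : ∀ k i, h k i = θ (⟨(k + (M - 2)) % M, Nat.mod_lt _ (by omega)⟩, i)) (k : ℕ) :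
    h (k + 2) = D ⟨k % M, Nat.mod_lt k (by omega)⟩ *ᵥ h (k + 1) - γ • h k
      + c ⟨k % M, Nat.mod_lt k (by omega)⟩ := by
  ext i
  have hrow := congrFun hθ (⟨k % M, Nat.mod_lt k (by omega)⟩, i)
  rw [blockOmega_mulVec hM] at hrow
  have h1 : h (k + 1) = fun l => θ (⟨(k % M + (M - 1)) % M, Nat.mod_lt _ (by omega)⟩, l) := by
    ext l
    simp only [hh, Nat.mod_add_mod, show k + 1 + (M - 2) = k + (M - 1) by omega]
  have h2 : h (k + 2) i = θ (⟨k % M, Nat.mod_lt k (by omega)⟩, i) := by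
    simp only [hh, show k + 2 + (M - 2) = k + M by omega, Nat.add_mod_right]
  rw [← h1, ← h2] at hrow
  simp only [Nat.mod_add_mod, ← hh] at hrow
  simp only [Pi.add_apply, Pi.sub_apply, Pi.smul_apply, smul_eq_mul]
  linarith

/-- Two monic split polynomials which agree have the same roots. -/
lemma exists_eq_of_prod_X_sub_C_eq {n : Type*} [Fintype n] {a b : n → ℝ}
    (h : ∏ j, (X - C (a j)) = ∏ j, (X - C (b j))) (i : n) : ∃ j, a i = b j := by
  have h1 := congrArg (Polynomial.eval (a i)) h
  rw [eval_prod, eval_prod, Finset.prod_eq_zero (Finset.mem_univ i) (by simp)] at h1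
  obtain ⟨j, -, hj⟩ := Finset.prod_eq_zero_iff.1 h1.symm
  exact ⟨j, by simpa [sub_eq_zero] using hj⟩

/-- If `γ ≠ 1`, `α ≠ 2(1+γ)/λ_j` for every `j`, and `γ > 1` or
`α > 2(1+γ)/λ_1`, then for all symmetric `Σ̂^{(m)}` close enough to `Σ` in operator
norm and all `b^{(m)}`, the block matrix `Ω` is invertible with stable solution
`θ* = αΩ⁻¹b*`, and there exist initial vectors `θ^{(0,M)} ≠ θ^{(M)}`,
`θ^{(0,M−1)} ≠ θ^{(M−1)}` for which `θ^{(t,M)}` does not converge to `θ^{(M)}`.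
The iterates are flattened into a sequence `u` with `u 0 = θ^{(0,M-1)}`,
`u 1 = θ^{(0,M)}`, and `u (M(t-1)+m+2) = θ^{(t,m+1)}` (`0`-based minibatch `m`), so
that `θ^{(t,M)} = u (M*t + 1)` for `t ≥ 1`. -/
theorem stmt12 (p M : ℕ) (hp : 1 ≤ p) (hM : 3 ≤ M)
    (S : Matrix (Fin p) (Fin p) ℝ) (hsymm : S.IsSymm)
    (lam : Fin p → ℝ) (hmono : Antitone lam) (hpos : ∀ j, 0 < lam j)
    (hchar : S.charpoly = ∏ j : Fin p, (X - C (lam j)))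
    (γ α : ℝ) (hγ0 : 0 ≤ γ) (hγ1 : γ ≠ 1) (hα0 : 0 < α)
    (halpha : ∀ j : Fin p, α ≠ 2 * (1 + γ) / lam j)
    (hdiv : 1 < γ ∨ 2 * (1 + γ) / lam ⟨0, hp⟩ < α) :
    ∃ ε > 0, ∀ Shat : Fin M → Matrix (Fin p) (Fin p) ℝ,
      (∀ m, (Shat m).IsSymm) → (∀ m, matOpNorm (Shat m - S) ≤ ε) →
      ∀ b : Fin M → (Fin p → ℝ),
        IsUnit (blockOmega M p γ
          (fun m => (1 + γ) • (1 : Matrix (Fin p) (Fin p) ℝ) - α • Shat m)) ∧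
        ∃ u : ℕ → (Fin p → ℝ),
          (∀ k : ℕ,
            u (k + 2) =
              ((1 + γ) • (1 : Matrix (Fin p) (Fin p) ℝ)
                  - α • Shat ⟨k % M, Nat.mod_lt k (by omega)⟩).mulVec (u (k + 1))
                - γ • u k + α • b ⟨k % M, Nat.mod_lt k (by omega)⟩) ∧
          u 1 ≠ (fun i : Fin p =>
            (α • (blockOmega M p γ
                (fun m' => (1 + γ) • (1 : Matrix (Fin p) (Fin p) ℝ)
                  - α • Shat m'))⁻¹.mulVec (fun x => b x.1 x.2))
              (⟨M - 1, by omega⟩, i)) ∧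
          u 0 ≠ (fun i : Fin p =>
            (α • (blockOmega M p γ
                (fun m' => (1 + γ) • (1 : Matrix (Fin p) (Fin p) ℝ)
                  - α • Shat m'))⁻¹.mulVec (fun x => b x.1 x.2))
              (⟨M - 2, by omega⟩, i)) ∧
          ¬ Tendsto (fun t : ℕ => u (M * t + 1)) atTop
              (nhds (fun i : Fin p =>
                (α • (blockOmega M p γ
                    (fun m' => (1 + γ) • (1 : Matrix (Fin p) (Fin p) ℝ)
                      - α • Shat m'))⁻¹.mulVec (fun x => b x.1 x.2))
                  (⟨M - 1, by omega⟩, i))) := by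
  have hS : S.IsHermitian := (conjTranspose_eq_transpose_of_trivial S).trans hsymm
  have hprod : ∏ j, (X - C (hS.eigenvalues j)) = ∏ j, (X - C (lam j)) := by
    rw [← hchar, hS.charpoly_eq]
    simp
  have hc : ∀ j, (1 + γ - α * hS.eigenvalues j) ^ 2 ≠ (1 + γ) ^ 2 := by
    intro j hj
    obtain ⟨k, hk⟩ := exists_eq_of_prod_X_sub_C_eq hprod j
    rw [hk] at hj
    have h1 : (α * lam k) * (α * lam k - 2 * (1 + γ)) = 0 := by linarith
    have h2 := (mul_eq_zero.1 h1).resolve_left (mul_pos hα0 (hpos k)).ne'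
    exact halpha k ((eq_div_iff (hpos k).ne').2 (by linarith))
  obtain ⟨i, hi⟩ := exists_eq_of_prod_X_sub_C_eq hprod.symm ⟨0, hp⟩
  have hi' : 1 < γ ∨ (1 + γ) ^ 2 < (1 + γ - α * hS.eigenvalues i) ^ 2 := by
    refine hdiv.imp_right fun h => ?_
    rw [div_lt_iff₀ (hpos _), hi] at h
    nlinarith
  obtain ⟨ε, hε, δ, hδ, Q, v, hQ, hQ0, hv, hstep⟩ :=
    exists_increasing_function hS hγ0 hγ1 hα0 hc i hi'
  refine ⟨ε, hε, fun Shat hsym hnear b => ?_⟩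
  have hM0 : 0 < M := by omega
  set D : Fin M → Matrix (Fin p) (Fin p) ℝ :=
    fun m => (1 + γ) • (1 : Matrix (Fin p) (Fin p) ℝ) - α • Shat m with hDdef
  set D' : ℕ → Matrix (Fin p) (Fin p) ℝ := fun k => D ⟨k % M, Nat.mod_lt k hM0⟩ with hD'
  have hstep' : ∀ k x y, Q x y + δ * (x ⬝ᵥ x + y ⬝ᵥ y) ≤ Q (D' k *ᵥ x - γ • y) x :=
    fun k => hstep _ (hnear _)
  have hunit : IsUnit (blockOmega M p γ D) := by
    rw [isUnit_iff_isUnit_det, isUnit_iff_ne_zero]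
    intro hdet
    obtain ⟨θ, hθ0, hθ⟩ := exists_mulVec_eq_zero_iff.2 hdet
    set h : ℕ → Fin p → ℝ := fun k i => θ (⟨(k + (M - 2)) % M, Nat.mod_lt _ hM0⟩, i) with hh
    have hrec := periodic_extension_recursion hM (c := 0) (h := h) hθ fun _ _ => rfl
    have hzero := periodic_solution_eq_zero hδ hstep' (M := M) (h := h)
      (fun k => by simpa using hrec k)
      (by ext l; simp [hh, Nat.add_mod_left])
      (by ext l; simp only [hh, show M + 1 + (M - 2) = 1 + (M - 2) + M by omega,
        Nat.add_mod_right])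
    refine hθ0 (funext fun ⟨m, l⟩ => ?_)
    have := congrFun (hzero ((m + 2) % M) (Nat.mod_lt _ hM0)) l
    simp only [hh, Nat.mod_add_mod, show (m : ℕ) + 2 + (M - 2) = m + M by omega,
      Nat.add_mod_right, Nat.mod_eq_of_lt m.2] at this
    exact this
  refine ⟨hunit, ?_⟩
  set θ : Fin M × Fin p → ℝ := α • (blockOmega M p γ D)⁻¹ *ᵥ (fun x => b x.1 x.2) with hθdef
  have hθ : blockOmega M p γ D *ᵥ θ = fun x => (α • b x.1) x.2 := by
    rw [hθdef, mulVec_smul, mulVec_mulVec,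
      mul_nonsing_inv _ ((isUnit_iff_isUnit_det _).1 hunit), one_mulVec]
    rfl
  set h : ℕ → Fin p → ℝ := fun k i => θ (⟨(k + (M - 2)) % M, Nat.mod_lt _ hM0⟩, i) with hh
  have hrec := periodic_extension_recursion hM (c := fun m => α • b m) (h := h) hθ
    fun _ _ => rfl
  have hlast : ∀ t, h (M * t + 1) = fun l => θ (⟨M - 1, by omega⟩, l) := fun t => by
    ext l
    simp only [hh, show M * t + 1 + (M - 2) = M - 1 + M * t by omega, Nat.add_mul_mod_self_left,
      Nat.mod_eq_of_lt (show M - 1 < M by omega)]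
  have hprev : h 0 = fun l => θ (⟨M - 2, by omega⟩, l) := by
    ext l
    simp only [hh, zero_add, Nat.mod_eq_of_lt (show M - 2 < M by omega)]
  obtain ⟨e, he0, he1, he, hlim⟩ := exists_solution_not_tendsto_zero hM0 (γ := γ) (D := D')
    (fun k => by
      simp only [hD', hDdef, IsSymm, transpose_sub, transpose_smul, transpose_one, (hsym _).eq])
    (fun j k (hjk : j % M = k % M) => by simp only [hD', hjk]) hQ hQ0 hv
    (fun k x y => le_trans (le_add_of_nonneg_right (mul_nonneg hδ.le
      (add_nonneg (dotProduct_self_nonneg_real x) (dotProduct_self_nonneg_real y))))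
      (hstep' k x y))
  refine ⟨fun k => h k + e k, fun k => ?_, ?_, ?_, ?_⟩
  · beta_reduce
    rw [hrec k, he k]
    simp only [hD', hDdef, mulVec_add, smul_add]
    abel
  · rw [← hlast 0]
    simpa using he1
  · rw [← hprev]
    simpa using he0
  · intro hconv
    refine hlim ?_
    have := hconv.sub_const (fun l => θ (⟨M - 1, by omega⟩, l))
    rw [sub_self] at this
    exact this.congr fun t => by rw [← hlast t, add_sub_cancel_left]
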